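/- arXiv:1708.00092 — 5 statements merged into one kernel-verified Lean document; each statement's English description precedes it below -/
import Mathlib

section
/- Let (Ω, 𝒻, P) be a probability space, Z : Ω → ℝ a random variable with 0 ≤ Z ≤ 1, 0 ≤ β ≤ 1 with α = 1 − β, and for t ≥ 1 let U_0, …, U_{t−1} : Ω → Ψ be measurable maps into a measurable space Ψ that are identically distributed, all with common distribution ν = P ∘ U_i⁻¹, and which satisfy only the following 'hitting' hypothesis: for every measurable set T ⊆ Ψ, P(⋂_{i<t} U_i⁻¹(T)) ≤ (α + β·ν(T))^t. For each i < t let W_i : Ψ → ℝ be a version of the conditional expectation E[Z|U_i], and set W = (W_0 + ⋯ + W_{t−1})/t. Then for every ε with 0 < ε < 1: E[Z] ≤ (α + β·ν{W > ε})^t + t·ε. -/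
open MeasureTheory ProbabilityTheory Finset

/-- A function with values in `[0, 1]` has integral at most the measure of an intersection plus
the sum of its integrals over the complements. -/
lemma integral_le_measureReal_iInter_add_sum {Ω ι : Type*} [Fintype ι] [MeasurableSpace Ω]
    (P : Measure Ω) [IsFiniteMeasure P] {Z : Ω → ℝ} (hZ : Integrable Z P)
    (hZ0 : ∀ ω, 0 ≤ Z ω) (hZ1 : ∀ ω, Z ω ≤ 1) {A : ι → Set Ω}
    (hA : ∀ i, MeasurableSet (A i)) :
    ∫ ω, Z ω ∂P ≤ P.real (⋂ i, A i) + ∑ i, ∫ ω in (A i)ᶜ, Z ω ∂P := by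
  have hI : MeasurableSet (⋂ i, A i) := MeasurableSet.iInter hA
  have hind : Integrable ((⋂ i, A i).indicator (1 : Ω → ℝ)) P :=
    (integrable_const (1 : ℝ)).indicator hI
  have hsum : ∀ i ∈ (univ : Finset ι), Integrable ((A i)ᶜ.indicator Z) P :=
    fun i _ ↦ hZ.indicator (hA i).compl
  calc ∫ ω, Z ω ∂P
      ≤ ∫ ω, ((⋂ i, A i).indicator (1 : Ω → ℝ) ω + ∑ i, (A i)ᶜ.indicator Z ω) ∂P := by
        refine integral_mono hZ (hind.add (integrable_finsetSum _ hsum)) fun ω ↦ ?_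
        have hnonneg : ∀ i ∈ (univ : Finset ι), 0 ≤ (A i)ᶜ.indicator Z ω :=
          fun i _ ↦ Set.indicator_nonneg (fun ω _ ↦ hZ0 ω) ω
        by_cases h : ω ∈ ⋂ i, A i
        · have := Finset.sum_nonneg hnonneg
          simp only [Set.indicator_of_mem h, Pi.one_apply]
          linarith [hZ1 ω]
        · obtain ⟨i, hi⟩ : ∃ i, ω ∉ A i := by simpa using h
          have := Finset.single_le_sum hnonneg (Finset.mem_univ i)
          rw [Set.indicator_of_mem (show ω ∈ (A i)ᶜ from hi)] at this
          simpa only [Set.indicator_of_notMem h, zero_add] using this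
    _ = P.real (⋂ i, A i) + ∑ i, ∫ ω in (A i)ᶜ, Z ω ∂P := by
        rw [integral_add hind (integrable_finsetSum _ hsum), integral_indicator_one hI,
          integral_finsetSum _ hsum]
        simp only [integral_indicator (hA _).compl]

/-- If `Z : Ω → ℝ` is a random variable with `0 ≤ Z ≤ 1`, `0 ≤ β ≤ 1`,
`α = 1 - β`, the `U i : Ω → Ψ` (`i < t`, `t ≥ 1`) are identically distributed with common
distribution `ν` and satisfy the hitting hypothesis
`P(⋂ i, U i ⁻¹ T) ≤ (α + β·ν T)^t` for every measurable `T`, `W' i` is a version of the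
conditional expectation `E[Z | U i]`, and `W` is the average of the `W' i`, then for
`0 < ε < 1` we have `E[Z] ≤ (α + β·ν{W > ε})^t + t·ε`. -/
theorem conditional_expectation_bound_hitting
    {Ω Ψ : Type*} [MeasurableSpace Ω] [MeasurableSpace Ψ]
    (P : Measure Ω) [IsProbabilityMeasure P]
    (Z : Ω → ℝ) (hZmeas : Measurable Z)
    (hZ0 : ∀ ω, 0 ≤ Z ω) (hZ1 : ∀ ω, Z ω ≤ 1)
    (α β : ℝ) (hβ0 : 0 ≤ β) (hβ1 : β ≤ 1) (hα : α = 1 - β)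
    (t : ℕ) (ht : 1 ≤ t)
    (U : Fin t → Ω → Ψ) (hUmeas : ∀ i, Measurable (U i))
    (ν : Measure Ψ) (hid : ∀ i, P.map (U i) = ν)
    (hhitting : ∀ T : Set Ψ, MeasurableSet T →
      (P (⋂ i, U i ⁻¹' T)).toReal ≤ (α + β * (ν T).toReal) ^ t)
    (W' : Fin t → Ψ → ℝ) (hW'meas : ∀ i, Measurable (W' i))
    (hCE : ∀ i, ∀ S : Set Ψ, MeasurableSet S →
      ∫ ω in (U i) ⁻¹' S, Z ω ∂P = ∫ y in S, W' i y ∂ν)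
    (W : Ψ → ℝ) (hW : ∀ y, W y = (∑ i, W' i y) / t)
    (ε : ℝ) (hε0 : 0 < ε) (hε1 : ε < 1) :
    ∫ ω, Z ω ∂P ≤ (α + β * (ν {y | ε < W y}).toReal) ^ t + t * ε := by
  have htpos : (0 : ℝ) < t := by exact_mod_cast ht
  have hνprob : IsProbabilityMeasure ν :=
    hid ⟨0, ht⟩ ▸ Measure.isProbabilityMeasure_map (hUmeas _).aemeasurable
  by_cases hint : ∀ i, Integrable (W' i) ν
  · have hWmeas : Measurable W := by
      rw [funext hW]
      exact (Finset.measurable_sum _ fun i _ ↦ hW'meas i).div_const _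
    have hZint : Integrable Z P := by
      refine Integrable.of_bound hZmeas.aestronglyMeasurable 1 (ae_of_all _ fun ω ↦ ?_)
      rw [Real.norm_of_nonneg (hZ0 ω)]
      exact hZ1 ω
    have hT : MeasurableSet {y | ε < W y} := measurableSet_lt measurable_const hWmeas
    have hWint : Integrable W ν := by
      rw [funext hW]
      exact (integrable_finsetSum _ fun i _ ↦ hint i).div_const _
    have hlow : ∫ y in {y | ε < W y}ᶜ, W y ∂ν ≤ ε :=
      calc ∫ y in {y | ε < W y}ᶜ, W y ∂ν
          ≤ ∫ _ in {y | ε < W y}ᶜ, ε ∂ν :=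
            setIntegral_mono_on hWint.integrableOn integrableOn_const hT.compl
              fun y hy ↦ not_lt.mp hy
        _ = ν.real {y | ε < W y}ᶜ * ε := by rw [setIntegral_const, smul_eq_mul]
        _ ≤ ε := mul_le_of_le_one_left hε0.le measureReal_le_one
    have hsum : ∑ i, ∫ ω in (U i ⁻¹' {y | ε < W y})ᶜ, Z ω ∂P =
        t * ∫ y in {y | ε < W y}ᶜ, W y ∂ν := by
      simp only [← Set.preimage_compl, hCE _ _ hT.compl]
      rw [← integral_finsetSum _ fun i _ ↦ (hint i).integrableOn, ← integral_const_mul]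
      simp only [hW, mul_div_cancel₀ _ htpos.ne']
    calc ∫ ω, Z ω ∂P
        ≤ P.real (⋂ i, U i ⁻¹' {y | ε < W y}) +
            ∑ i, ∫ ω in (U i ⁻¹' {y | ε < W y})ᶜ, Z ω ∂P :=
          integral_le_measureReal_iInter_add_sum P hZint hZ0 hZ1 fun i ↦ hUmeas i hT
      _ ≤ (α + β * (ν {y | ε < W y}).toReal) ^ t + t * ε := by
          rw [hsum]
          exact add_le_add (hhitting _ hT) (mul_le_mul_of_nonneg_left hlow htpos.le)
  · -- A non-integrable `W' i` has Bochner integral `0`, which forces `E[Z] = 0`.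
    obtain ⟨i, hi⟩ := not_forall.mp hint
    have hzero : ∫ ω, Z ω ∂P = 0 := by
      simpa [integral_undef hi] using hCE i Set.univ MeasurableSet.univ
    have hα0 : 0 ≤ α := by linarith
    rw [hzero]
    positivity
end

section
/- Let A be a real symmetric N×N matrix (N ≥ 1) with A·𝟙 = 𝟙 (where 𝟙 is the all-ones vector), and suppose there is α with 0 ≤ α ≤ 1 such that ‖A·y‖ ≤ α‖y‖ for every y ∈ ℝ^N orthogonal to 𝟙; let β = 1 − α. Let S, S' ⊆ {0, 1, …, N−1} with projection matrices P = P_S and P' = P_{S'}, and set μ = |S|/N, μ' = |S'|/N. Then for every vector v ∈ ℝ^N: ‖P·A·P'·v‖ ≤ (α + βμ)^{1/2}·(α + βμ')^{1/2}·‖v‖. -/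
open Finset Matrix

/-- The Euclidean norm of a vector in `Fin N → ℝ`. -/
noncomputable def euclNorm {N : ℕ} (v : Fin N → ℝ) : ℝ :=
  Real.sqrt (∑ i, v i ^ 2)

/-- The projection matrix of a set `S` of coordinates: the diagonal 0/1 matrix with a `1`
exactly at the positions in `S`. -/
def projMat {N : ℕ} (S : Finset (Fin N)) : Matrix (Fin N) (Fin N) ℝ :=
  Matrix.diagonal (fun i => if i ∈ S then 1 else 0)

lemma sq_dotProduct_mulVec_le_of_contract {N : ℕ} (hN : 1 ≤ N)
    {A : Matrix (Fin N) (Fin N) ℝ} (hsymm : A.IsSymm)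
    (hones : A.mulVec (fun _ => 1) = fun _ => 1) {α : ℝ} (hα0 : 0 ≤ α)
    (hcontract : ∀ y : Fin N → ℝ, (∑ i, y i * 1) = 0 →
      euclNorm (A.mulVec y) ≤ α * euclNorm y)
    (u x : Fin N → ℝ) :
    (u ⬝ᵥ A.mulVec x) ^ 2 ≤
      (α * ∑ i, u i ^ 2 + (1 - α) * ((∑ i, u i) ^ 2 / N)) *
        (α * ∑ i, x i ^ 2 + (1 - α) * ((∑ i, x i) ^ 2 / N)) := by
  have hN0 : (N : ℝ) ≠ 0 := by positivity
  have hmean (z : Fin N → ℝ) : ∑ i, (z i - (∑ j, z j) / N) = 0 := by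
    simp [Finset.sum_sub_distrib, mul_div_cancel₀ _ hN0]
  have hvar (z : Fin N → ℝ) :
      ∑ i, (z i - (∑ j, z j) / N) ^ 2 = ∑ i, z i ^ 2 - (∑ i, z i) ^ 2 / N := by
    simp only [sub_sq, Finset.sum_add_distrib, Finset.sum_sub_distrib, ← Finset.sum_mul,
      ← Finset.mul_sum, Finset.sum_const, Finset.card_univ, Fintype.card_fin, nsmul_eq_mul]
    field_simp
    ring
  set a := (∑ j, u j) / N with ha
  set b := (∑ j, x j) / N with hb
  set u' : Fin N → ℝ := fun i => u i - a with hu'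
  set x' : Fin N → ℝ := fun i => x i - b with hx'
  have hsum_mulVec : ∑ i, A.mulVec x' i = 0 := by
    have h : (fun _ => (1 : ℝ)) ⬝ᵥ A.mulVec x' = (fun _ => (1 : ℝ)) ⬝ᵥ x' := by
      rw [Matrix.dotProduct_mulVec, ← Matrix.mulVec_transpose, hsymm.eq, hones]
    simpa [dotProduct, hx', hmean x, hb] using h
  have hAx : A.mulVec x = fun i => A.mulVec x' i + b := by
    have h : x = x' + b • fun _ => (1 : ℝ) := by
      ext i
      simp [hx']
    conv_lhs => rw [h, Matrix.mulVec_add, Matrix.mulVec_smul, hones]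
    ext i
    simp
  have hsplit : u ⬝ᵥ A.mulVec x = N * a * b + ∑ i, u' i * A.mulVec x' i := by
    rw [hAx]
    simp only [dotProduct, hu', sub_mul, mul_add, Finset.sum_add_distrib,
      Finset.sum_sub_distrib, ← Finset.sum_mul, ← Finset.mul_sum, hsum_mulVec]
    have : (N : ℝ) * a = ∑ i, u i := by rw [ha]; field_simp
    rw [this]
    ring
  have hbound : ∑ i, (A.mulVec x' i) ^ 2 ≤ α ^ 2 * ∑ i, x' i ^ 2 := by
    have h := hcontract x' (by simpa [hx', hb] using hmean x)
    have h2 := pow_le_pow_left₀ (Real.sqrt_nonneg _) h 2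
    simp only [euclNorm] at h2
    rwa [mul_pow, Real.sq_sqrt (by positivity), Real.sq_sqrt (by positivity)] at h2
  have hU : α * ∑ i, u i ^ 2 + (1 - α) * ((∑ i, u i) ^ 2 / N) =
      N * a ^ 2 + α * ∑ i, u' i ^ 2 := by
    rw [hu', ha, hvar u]
    field_simp
    ring
  have hX : α * ∑ i, x i ^ 2 + (1 - α) * ((∑ i, x i) ^ 2 / N) =
      N * b ^ 2 + α * ∑ i, x' i ^ 2 := by
    rw [hx', hb, hvar x]
    field_simp
    ring
  rw [hU, hX, hsplit]
  have hCS := Finset.sum_mul_sq_le_sq_mul_sq Finset.univ u' (A.mulVec x')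
  have hR : 0 ≤ ∑ i, u' i ^ 2 := by positivity
  have hT : 0 ≤ ∑ i, x' i ^ 2 := by positivity
  generalize ∑ i, u' i * A.mulVec x' i = c at *
  generalize ∑ i, u' i ^ 2 = R at *
  generalize ∑ i, x' i ^ 2 = T at *
  have hc : c ^ 2 ≤ (α * R) * (α * T) := by
    nlinarith [mul_le_mul_of_nonneg_left hbound hR]
  have hcross : 2 * (N * a * b) * c ≤ N * a ^ 2 * (α * T) + α * R * (N * b ^ 2) := by
    refine le_of_abs_le (abs_le_of_sq_le_sq ?_ (by positivity))
    have hN2 : 0 ≤ 4 * (N * a * b) ^ 2 := by positivity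
    nlinarith [mul_le_mul_of_nonneg_left hc hN2,
      sq_nonneg (N * a ^ 2 * (α * T) - α * R * (N * b ^ 2))]
  nlinarith

lemma projMat_mulVec_apply {N : ℕ} (S : Finset (Fin N)) (v : Fin N → ℝ) (i : Fin N) :
    (projMat S).mulVec v i = if i ∈ S then v i else 0 := by
  simp [projMat, Matrix.mulVec_diagonal]

lemma sq_sum_projMat_mulVec_le {N : ℕ} (S : Finset (Fin N)) (v : Fin N → ℝ) :
    (∑ i, (projMat S).mulVec v i) ^ 2 ≤ S.card * ∑ i, (projMat S).mulVec v i ^ 2 := by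
  simp only [projMat_mulVec_apply, ite_pow, ne_eq, OfNat.ofNat_ne_zero, not_false_eq_true,
    zero_pow, Finset.sum_ite_mem, Finset.univ_inter]
  exact sq_sum_le_card_mul_sum_sq

lemma sum_sq_projMat_mulVec_le {N : ℕ} (S : Finset (Fin N)) (v : Fin N → ℝ) :
    ∑ i, (projMat S).mulVec v i ^ 2 ≤ ∑ i, v i ^ 2 := by
  refine Finset.sum_le_sum fun i _ => ?_
  rw [projMat_mulVec_apply]
  split_ifs
  · exact le_rfl
  · simpa using sq_nonneg (v i)

/-- Let `A` be a real symmetric `N×N` matrix fixing the all-ones vector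
and contracting by a factor `α ∈ [0,1]` on the orthogonal complement of the all-ones
vector, and `β = 1 - α`.  If `P, P'` are the projection matrices of sets `S, S'` of
densities `μ = |S|/N`, `μ' = |S'|/N`, then for every vector `v`,
`‖P·A·P'·v‖ ≤ √(α + βμ)·√(α + βμ')·‖v‖`. -/
theorem projected_expander_operator_bound
    (N : ℕ) (hN : 1 ≤ N)
    (A : Matrix (Fin N) (Fin N) ℝ) (hsymm : A.IsSymm)
    (hones : A.mulVec (fun _ => 1) = fun _ => 1)
    (α : ℝ) (hα0 : 0 ≤ α) (hα1 : α ≤ 1)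
    (hcontract : ∀ y : Fin N → ℝ, (∑ i, y i * 1) = 0 →
      euclNorm (A.mulVec y) ≤ α * euclNorm y)
    (β : ℝ) (hβ : β = 1 - α)
    (S S' : Finset (Fin N))
    (μ μ' : ℝ) (hμ : μ = (S.card : ℝ) / N) (hμ' : μ' = (S'.card : ℝ) / N)
    (v : Fin N → ℝ) :
    euclNorm ((projMat S * A * projMat S').mulVec v) ≤
      Real.sqrt (α + β * μ) * Real.sqrt (α + β * μ') * euclNorm v := by
  subst hβ hμ hμ'
  have hβ0 : 0 ≤ 1 - α := sub_nonneg.2 hα1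
  set x := (projMat S').mulVec v with hx
  set u := (projMat S).mulVec (A.mulVec x) with hu
  have hPAP : (projMat S * A * projMat S').mulVec v = u := by
    simp only [hu, hx, Matrix.mulVec_mulVec, Matrix.mul_assoc]
  have hinner : u ⬝ᵥ A.mulVec x = ∑ i, u i ^ 2 := by
    refine Finset.sum_congr rfl fun i _ => ?_
    rw [hu, projMat_mulVec_apply]
    split_ifs <;> ring
  have hdensity (T : Finset (Fin N)) (w : Fin N → ℝ) :
      α * ∑ i, (projMat T).mulVec w i ^ 2 +
          (1 - α) * ((∑ i, (projMat T).mulVec w i) ^ 2 / N) ≤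
        (α + (1 - α) * (T.card / N)) * ∑ i, (projMat T).mulVec w i ^ 2 := by
    rw [add_mul, mul_assoc (1 - α), div_mul_eq_mul_div]
    gcongr
    exact sq_sum_projMat_mulVec_le T w
  have hp : 0 ≤ α + (1 - α) * (S.card / N : ℝ) := by positivity
  have hq : 0 ≤ α + (1 - α) * (S'.card / N : ℝ) := by positivity
  have hbil := sq_dotProduct_mulVec_le_of_contract hN hsymm hones hα0 hcontract u x
  rw [hinner] at hbil
  have hmain : (∑ i, u i ^ 2) ^ 2 ≤
      ((α + (1 - α) * (S.card / N)) * ∑ i, u i ^ 2) *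
        ((α + (1 - α) * (S'.card / N)) * ∑ i, v i ^ 2) := by
    refine hbil.trans (mul_le_mul (hdensity S _) ((hdensity S' v).trans ?_) (by positivity)
      (by positivity))
    exact mul_le_mul_of_nonneg_left (sum_sq_projMat_mulVec_le S' v) hq
  rw [hPAP, euclNorm, euclNorm, ← Real.sqrt_mul hp, ← Real.sqrt_mul (mul_nonneg hp hq)]
  apply Real.sqrt_le_sqrt
  have hV : 0 ≤ ∑ i, v i ^ 2 := by positivity
  rcases (show 0 ≤ ∑ i, u i ^ 2 by positivity).eq_or_lt with h0 | hpos
  · rw [← h0]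
    positivity
  · refine le_of_mul_le_mul_left ?_ hpos
    linarith
end

section
/- Let G = (V, E) be a d-regular undirected graph on N vertices whose transition matrix A (entries 1/d on edges, 0 otherwise) satisfies ‖A·y‖ ≤ α‖y‖ for every y ∈ ℝ^N orthogonal to the all-ones vector, where 0 ≤ α < 1 and β = 1 − α. Let F be a permutation of V and form the directed graph G' = (V, E') with E' = {(u, F(v)) : {u, v} ∈ E}. Let Ω be the set of directed t-walks in G' with the uniform probability measure P, and let U_i(y_0, …, y_t) = y_i for 0 ≤ i ≤ t be the projection maps. Then the U_i are β-independent: for all subsets S_0, …, S_t ⊆ V, P(⋂_{0≤i≤t} U_i⁻¹(S_i)) ≤ ∏_{0≤i≤t} (α + β·μ_i), where μ_i = P(U_i⁻¹(S_i)). -/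
open Finset Matrix

section Walks

variable {V : Type*} [Fintype V]

/-- The expander mixing inequality for a doubly stochastic matrix contracting the orthogonal
complement of the constants. -/
theorem sq_sum_mul_mulVec_le [Nonempty V] {M : Matrix V V ℝ} (hrow : ∀ u, ∑ v, M u v = 1)
    (hcol : ∀ v, ∑ u, M u v = 1) {α : ℝ} (hα0 : 0 ≤ α)
    (hM : ∀ y : V → ℝ, ∑ i, y i = 0 → ∑ i, (M *ᵥ y) i ^ 2 ≤ α ^ 2 * ∑ i, y i ^ 2)
    (x y : V → ℝ) :
    (∑ u, x u * (M *ᵥ y) u) ^ 2 ≤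
      (α * ∑ u, x u ^ 2 + (1 - α) * ((∑ u, x u) ^ 2 / Fintype.card V)) *
        (α * ∑ u, y u ^ 2 + (1 - α) * ((∑ u, y u) ^ 2 / Fintype.card V)) := by
  have hn : (Fintype.card V : ℝ) ≠ 0 := by simp
  have hn0 : (0 : ℝ) < Fintype.card V := by positivity
  have center_sum (z : V → ℝ) : ∑ u, (z u - (∑ v, z v) / Fintype.card V) = 0 := by
    simp [Finset.sum_sub_distrib]; field_simp; simp
  have center_sq (z : V → ℝ) : ∑ u, (z u - (∑ v, z v) / Fintype.card V) ^ 2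
      = ∑ u, z u ^ 2 - (∑ u, z u) ^ 2 / Fintype.card V := by
    simp_rw [sub_sq, Finset.sum_add_distrib, Finset.sum_sub_distrib, ← Finset.sum_mul,
      ← Finset.mul_sum]
    simp; field_simp; ring
  set n : ℝ := (Fintype.card V : ℝ)
  set a := (∑ u, x u) / n
  set b := (∑ u, y u) / n
  have hMy (u : V) : (M *ᵥ y) u = b + (M *ᵥ fun v => y v - b) u := by
    simp only [Matrix.mulVec, dotProduct, mul_sub, Finset.sum_sub_distrib, ← Finset.sum_mul, hrow]
    ring
  have hzero : ∑ u, (M *ᵥ fun v => y v - b) u = 0 := by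
    simp only [Matrix.mulVec, dotProduct]
    rw [Finset.sum_comm]
    simp_rw [← Finset.sum_mul, hcol, one_mul]
    exact center_sum y
  have hsplit : ∑ u, x u * (M *ᵥ y) u
      = (∑ u, x u) * b + ∑ u, (x u - a) * (M *ᵥ fun v => y v - b) u := by
    simp_rw [hMy, mul_add, sub_mul, Finset.sum_add_distrib, Finset.sum_sub_distrib,
      ← Finset.mul_sum, ← Finset.sum_mul, hzero]
    ring
  have hr : (∑ u, (x u - a) * (M *ᵥ fun v => y v - b) u) ^ 2
      ≤ (∑ u, (x u - a) ^ 2) * (α ^ 2 * ∑ u, (y u - b) ^ 2) :=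
    (Finset.sum_mul_sq_le_sq_mul_sq _ _ _).trans
      (mul_le_mul_of_nonneg_left (hM _ (center_sum y)) (Finset.sum_nonneg fun _ _ => sq_nonneg _))
  have hx0 : 0 ≤ ∑ u, (x u - a) ^ 2 := Finset.sum_nonneg fun _ _ => sq_nonneg _
  have hy0 : 0 ≤ ∑ u, (y u - b) ^ 2 := Finset.sum_nonneg fun _ _ => sq_nonneg _
  rw [hsplit]
  have hX : ∑ u, x u ^ 2 = ∑ u, (x u - a) ^ 2 + (∑ u, x u) ^ 2 / n := by
    rw [center_sq]; ring
  have hY : ∑ u, y u ^ 2 = ∑ u, (y u - b) ^ 2 + (∑ u, y u) ^ 2 / n := by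
    rw [center_sq]; ring
  rw [hX, hY]
  have hp : 0 ≤ (∑ u, x u) ^ 2 / n := by positivity
  have hq : 0 ≤ (∑ u, y u) ^ 2 / n := by positivity
  have hm : ((∑ u, x u) * b) ^ 2 = ((∑ u, x u) ^ 2 / n) * ((∑ u, y u) ^ 2 / n) := by
    simp only [b]; field_simp
  generalize (∑ u, x u) ^ 2 / n = p at *
  generalize (∑ u, y u) ^ 2 / n = q at *
  generalize ∑ u, (x u - a) ^ 2 = X at *
  generalize ∑ u, (y u - b) ^ 2 = Y at *
  generalize ∑ u, (x u - a) * (M *ᵥ fun v => y v - b) u = r at *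
  generalize (∑ u, x u) * b = m at *
  have hcross : 2 * m * r ≤ α * (p * Y + q * X) := by
    refine abs_le_of_sq_le_sq' ?_ (by positivity) |>.2
    calc (2 * m * r) ^ 2 = 4 * (p * q) * r ^ 2 := by rw [← hm]; ring
      _ ≤ 4 * (p * q) * (X * (α ^ 2 * Y)) := by gcongr
      _ ≤ (α * (p * Y + q * X)) ^ 2 := by nlinarith [sq_nonneg (α * (p * Y - q * X))]
  nlinarith

theorem sum_sq_le_card_mul_of_support {x : V → ℝ} {S : Finset V} (hx : ∀ u ∉ S, x u = 0) :
    (∑ u, x u) ^ 2 ≤ #S * ∑ u, x u ^ 2 := by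
  rw [← Finset.sum_subset (subset_univ S) fun u _ hu => hx u hu,
    ← Finset.sum_subset (subset_univ S) fun u _ hu => by simp [hx u hu]]
  exact sq_sum_le_card_mul_sum_sq

theorem mixing_energy_le {α : ℝ} (hα1 : α < 1) {x : V → ℝ} {S : Finset V}
    (hx : ∀ u ∉ S, x u = 0) :
    α * ∑ u, x u ^ 2 + (1 - α) * ((∑ u, x u) ^ 2 / Fintype.card V)
      ≤ (α + (1 - α) * (#S / Fintype.card V)) * ∑ u, x u ^ 2 := by
  have h : (∑ u, x u) ^ 2 / Fintype.card V ≤ #S * (∑ u, x u ^ 2) / Fintype.card V := by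
    gcongr
    exact sum_sq_le_card_mul_of_support hx
  have hβ := sub_nonneg.2 hα1.le
  calc _ ≤ α * ∑ u, x u ^ 2 + (1 - α) * (#S * (∑ u, x u ^ 2) / Fintype.card V) := by gcongr
    _ = _ := by ring

variable [DecidableEq V]

/-- The total `M`-weight of the walks `u = y₀, …, y_t` with `y_i ∈ S i` for all `i`. -/
noncomputable def walkMass (M : Matrix V V ℝ) : (t : ℕ) → (Fin (t + 1) → Finset V) → V → ℝ
  | 0, S, u => if u ∈ S 0 then 1 else 0
  | t + 1, S, u => if u ∈ S 0 then ∑ v, M u v * walkMass M t (fun i => S i.succ) v else 0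

theorem sum_walks_eq_sum_walkMass (M : Matrix V V ℝ) (t : ℕ) (S : Fin (t + 1) → Finset V)
    (h : V → ℝ) :
    ∑ w : Fin (t + 1) → V, h (w 0) *
        ((∏ i : Fin t, M (w i.castSucc) (w i.succ)) * (if ∀ i, w i ∈ S i then 1 else 0))
      = ∑ u, h u * walkMass M t S u := by
  induction t generalizing h with
  | zero =>
    rw [← (Equiv.funUnique (Fin 1) V).symm.sum_comp]
    simp [walkMass]
  | succ t ih =>
    rw [← (Fin.consEquiv fun _ => V).sum_comp, Fintype.sum_prod_type]
    refine Finset.sum_congr rfl fun u _ => ?_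
    have key := ih (fun i => S i.succ) (fun v => M u v)
    by_cases hu : u ∈ S 0
    · simp only [walkMass, hu, if_true]
      rw [← key, Finset.mul_sum]
      refine Finset.sum_congr rfl fun w _ => ?_
      simp [Fin.forall_fin_succ (n := t + 1), Fin.prod_univ_succ (n := t), hu]
    · simp [walkMass, hu, Fin.forall_fin_succ (n := t + 1)]

theorem walkMass_eq_zero_of_notMem (M : Matrix V V ℝ) {t : ℕ} {S : Fin (t + 1) → Finset V} {u : V}
    (hu : u ∉ S 0) : walkMass M t S u = 0 := by
  cases t <;> simp [walkMass, hu]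

theorem walkMass_univ {M : Matrix V V ℝ} (hrow : ∀ u, ∑ v, M u v = 1) (t : ℕ) (u : V) :
    walkMass M t (fun _ => univ) u = 1 := by
  induction t generalizing u with
  | zero => simp [walkMass]
  | succ t ih => simp [walkMass, ih, hrow]

theorem sum_walkMass_update_univ {M : Matrix V V ℝ} (hrow : ∀ u, ∑ v, M u v = 1)
    (hcol : ∀ v, ∑ u, M u v = 1) (t : ℕ) (i : Fin (t + 1)) (T : Finset V) :
    ∑ u, walkMass M t (fun j => if j = i then T else univ) u = #T := by
  induction t with
  | zero =>
    obtain rfl : i = 0 := Subsingleton.elim (α := Fin 1) i 0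
    simp [walkMass]
  | succ t ih =>
    cases i using Fin.cases with
    | zero => simp [walkMass, walkMass_univ hrow, hrow]
    | succ i =>
      simp only [walkMass, (Fin.succ_ne_zero i).symm, if_false, mem_univ, if_true, Fin.succ_inj]
      rw [Finset.sum_comm]
      simp_rw [← Finset.sum_mul, hcol, one_mul]
      exact ih i

theorem sum_sq_walkMass_le [Nonempty V] {M : Matrix V V ℝ} (hrow : ∀ u, ∑ v, M u v = 1)
    (hcol : ∀ v, ∑ u, M u v = 1) {α : ℝ} (hα0 : 0 ≤ α) (hα1 : α < 1)
    (hM : ∀ y : V → ℝ, ∑ i, y i = 0 → ∑ i, (M *ᵥ y) i ^ 2 ≤ α ^ 2 * ∑ i, y i ^ 2)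
    (t : ℕ) (S : Fin (t + 1) → Finset V) :
    (α + (1 - α) * (#(S 0) / Fintype.card V)) * ∑ u, walkMass M t S u ^ 2
      ≤ Fintype.card V * ∏ i, (α + (1 - α) * (#(S i) / Fintype.card V)) ^ 2 := by
  have hn0 : (0 : ℝ) < Fintype.card V := by positivity
  have hβ := sub_nonneg.2 hα1.le
  induction t with
  | zero =>
    have hle : (#(S 0) : ℝ) / Fintype.card V ≤ 1 :=
      div_le_one_of_le₀ (by exact_mod_cast card_le_univ _) hn0.le
    have hs : ∑ u, walkMass M 0 S u ^ 2 = Fintype.card V * (#(S 0) / Fintype.card V : ℝ) := by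
      rw [mul_div_cancel₀ _ hn0.ne']
      simp [walkMass]
    rw [hs]
    simp only [Nat.reduceAdd, Fin.prod_univ_one]
    have h0 : (0 : ℝ) ≤ #(S 0) / Fintype.card V := by positivity
    generalize (#(S 0) : ℝ) / Fintype.card V = s at *
    have hc : 0 ≤ α + (1 - α) * s := by positivity
    have hsc : s ≤ α + (1 - α) * s := by nlinarith
    calc _ = Fintype.card V * ((α + (1 - α) * s) * s) := by ring
      _ ≤ Fintype.card V * ((α + (1 - α) * s) * (α + (1 - α) * s)) := by gcongr
      _ = _ := by ring
  | succ t ih =>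
    have ih := ih fun i => S i.succ
    rw [Fin.prod_univ_succ]
    set y := walkMass M t fun i => S i.succ
    set x := walkMass M (t + 1) S
    have hxy : ∑ u, x u * (M *ᵥ y) u = ∑ u, x u ^ 2 := by
      refine Finset.sum_congr rfl fun u _ => ?_
      by_cases hu : u ∈ S 0
      · have : x u = (M *ᵥ y) u := by simp [x, y, walkMass, hu, Matrix.mulVec, dotProduct]
        rw [← this, sq]
      · simp [x, walkMass_eq_zero_of_notMem M hu]
    have hmix := sq_sum_mul_mulVec_le hrow hcol hα0 hM x y
    rw [hxy] at hmix
    have hx := mixing_energy_le hα1 (x := x) (S := S 0)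
      fun u hu => walkMass_eq_zero_of_notMem M hu
    have hy := mixing_energy_le hα1 (x := y) (S := S (Fin.succ 0))
      fun u hu => walkMass_eq_zero_of_notMem M hu
    have hX : 0 ≤ ∑ u, x u ^ 2 := Finset.sum_nonneg fun _ _ => sq_nonneg _
    have hY : 0 ≤ ∑ u, y u ^ 2 := Finset.sum_nonneg fun _ _ => sq_nonneg _
    have hc (i) : 0 ≤ α + (1 - α) * (#(S i) / Fintype.card V : ℝ) := by positivity
    have hle := hmix.trans (mul_le_mul hx hy (by positivity) (mul_nonneg (hc 0) hX))
    have hc0 := hc 0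
    have hc1 := hc (Fin.succ 0)
    generalize α + (1 - α) * (#(S 0) / Fintype.card V : ℝ) = c at *
    generalize α + (1 - α) * (#(S (Fin.succ 0)) / Fintype.card V : ℝ) = c' at *
    generalize ∑ u, x u ^ 2 = X at *
    generalize ∑ u, y u ^ 2 = Y at *
    have hstep : X ≤ c * (c' * Y) := by
      rcases hX.eq_or_lt with h | h
      · rw [← h]
        exact mul_nonneg hc0 (mul_nonneg hc1 hY)
      · nlinarith
    calc c * X ≤ c * (c * (c' * Y)) := by gcongr
      _ = c ^ 2 * (c' * Y) := by ring
      _ ≤ c ^ 2 * (Fintype.card V *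
            ∏ i : Fin (t + 1), (α + (1 - α) * (#(S i.succ) / Fintype.card V)) ^ 2) := by gcongr
      _ = _ := by ring

theorem sum_walkMass_le [Nonempty V] {M : Matrix V V ℝ} (hrow : ∀ u, ∑ v, M u v = 1)
    (hcol : ∀ v, ∑ u, M u v = 1) {α : ℝ} (hα0 : 0 ≤ α) (hα1 : α < 1)
    (hM : ∀ y : V → ℝ, ∑ i, y i = 0 → ∑ i, (M *ᵥ y) i ^ 2 ≤ α ^ 2 * ∑ i, y i ^ 2)
    (t : ℕ) (S : Fin (t + 1) → Finset V) :
    (∑ u, walkMass M t S u) / Fintype.card V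
      ≤ ∏ i, (α + (1 - α) * (#(S i) / Fintype.card V)) := by
  have hn0 : (0 : ℝ) < Fintype.card V := by positivity
  have hβ := sub_nonneg.2 hα1.le
  have hle : (#(S 0) : ℝ) / Fintype.card V ≤ 1 :=
    div_le_one_of_le₀ (by exact_mod_cast card_le_univ _) hn0.le
  have hsc : (#(S 0) : ℝ) / Fintype.card V ≤ α + (1 - α) * (#(S 0) / Fintype.card V) := by
    nlinarith
  have hX : 0 ≤ ∑ u, walkMass M t S u ^ 2 := Finset.sum_nonneg fun _ _ => sq_nonneg _
  refine abs_le_of_sq_le_sq' ?_ (Finset.prod_nonneg fun i _ => by positivity) |>.2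
  calc ((∑ u, walkMass M t S u) / Fintype.card V) ^ 2
      ≤ (#(S 0) * ∑ u, walkMass M t S u ^ 2) / (Fintype.card V : ℝ) ^ 2 := by
        rw [div_pow]
        gcongr
        exact sum_sq_le_card_mul_of_support fun u hu => walkMass_eq_zero_of_notMem M hu
    _ = (#(S 0) / Fintype.card V * ∑ u, walkMass M t S u ^ 2) / Fintype.card V := by
        field_simp
    _ ≤ ((α + (1 - α) * (#(S 0) / Fintype.card V)) * ∑ u, walkMass M t S u ^ 2)
          / Fintype.card V := by gcongr
    _ ≤ (Fintype.card V * ∏ i, (α + (1 - α) * (#(S i) / Fintype.card V)) ^ 2)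
          / Fintype.card V := by
        exact div_le_div_of_nonneg_right (sum_sq_walkMass_le hrow hcol hα0 hα1 hM t S) hn0.le
    _ = _ := by rw [mul_div_cancel_left₀ _ hn0.ne', Finset.prod_pow]

/-- Counting walks is summing `walkMass` for the normalised adjacency matrix. -/
theorem card_walks_div_pow (R : V → V → Prop) [DecidableRel R] (d t : ℕ)
    (S : Fin (t + 1) → Finset V) :
    (#{w : Fin (t + 1) → V | (∀ i : Fin t, R (w i.castSucc) (w i.succ)) ∧ ∀ i, w i ∈ S i} : ℝ)
        / d ^ t
      = ∑ u, walkMass (Matrix.of fun u v => if R u v then 1 / (d : ℝ) else 0) t S u := by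
  have h := sum_walks_eq_sum_walkMass
    (Matrix.of fun u v => if R u v then 1 / (d : ℝ) else 0) t S fun _ => 1
  simp only [one_mul] at h
  rw [← h, Finset.card_filter, Nat.cast_sum, Finset.sum_div]
  refine Finset.sum_congr rfl fun w _ => ?_
  by_cases hw : ∀ i : Fin t, R (w i.castSucc) (w i.succ)
  · by_cases hS : ∀ i, w i ∈ S i <;> simp [hw, hS]
  · obtain ⟨i, hi⟩ := not_forall.1 hw
    rw [Finset.prod_eq_zero (mem_univ i) (by simp [hi])]
    simp [hw]

end Walks

/-- Let `G = (V, E)` be a `d`-regular undirected graph on `N` vertices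
whose transition matrix `A` contracts by a factor `α ∈ [0,1)` on the orthogonal
complement of the all-ones vector, `β = 1 - α`, `F` a permutation of `V`, and
`G' = (V, E')` the directed graph with `E' = {(u, F v) : {u, v} ∈ E}`.  Equip the set
of directed `t`-walks in `G'` (of which there are `N·d^t`) with the uniform measure, and
let `U i` be the `i`-th vertex projection.  Then the `U i` are β-independent: for all
`S₀, …, S_t ⊆ V`, `P(⋂ i, U i ⁻¹ (S i)) ≤ ∏ i, (α + β·μ i)` where
`μ i = P(U i ⁻¹ (S i))`. -/
theorem beta_independence_of_expander_permutation_walks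
    (N d t : ℕ) (hN : 1 ≤ N) (hd : 1 ≤ d)
    (E : Fin N → Fin N → Prop) [DecidableRel E]
    (hsymmE : ∀ u v, E u v ↔ E v u)
    (hreg : ∀ u, (Finset.univ.filter (fun v => E u v)).card = d)
    (A : Matrix (Fin N) (Fin N) ℝ)
    (hA : ∀ i j, A i j = if E i j then 1 / (d : ℝ) else 0)
    (α β : ℝ) (hα0 : 0 ≤ α) (hα1 : α < 1) (hβ : β = 1 - α)
    (hcontract : ∀ y : Fin N → ℝ, (∑ i, y i) = 0 →
      euclNorm (A.mulVec y) ≤ α * euclNorm y)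
    (F : Equiv.Perm (Fin N))
    (E' : Fin N → Fin N → Prop) [DecidableRel E'] (hE' : ∀ u w, E' u w ↔ ∃ v, E u v ∧ F v = w)
    (S : Fin (t + 1) → Finset (Fin N))
    (μ : Fin (t + 1) → ℝ)
    (hμ : ∀ i, μ i =
      ((Finset.univ.filter (fun w : Fin (t + 1) → Fin N =>
          (∀ i' : Fin t, E' (w i'.castSucc) (w i'.succ)) ∧ w i ∈ S i)).card : ℝ)
        / (N * d ^ t)) :
    ((Finset.univ.filter (fun w : Fin (t + 1) → Fin N =>
        (∀ i' : Fin t, E' (w i'.castSucc) (w i'.succ)) ∧ ∀ i, w i ∈ S i)).card : ℝ)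
      / (N * d ^ t)
    ≤ ∏ i, (α + β * μ i) := by
  have : Nonempty (Fin N) := ⟨⟨0, hN⟩⟩
  have hd0 : (d : ℝ) ≠ 0 := by positivity
  set M : Matrix (Fin N) (Fin N) ℝ := Matrix.of fun u v => if E' u v then 1 / (d : ℝ) else 0
  have hMA (u v) : M u (F v) = A u v := by
    have : E' u (F v) ↔ E u v := by simp [hE']
    simp [M, hA, this]
  have hArow (u) : ∑ v, A u v = 1 := by
    simp only [hA, ← Finset.sum_filter, Finset.sum_const, hreg]
    simp [hd0]
  have hrow (u) : ∑ v, M u v = 1 := by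
    rw [← Equiv.sum_comp F]
    simp only [hMA, hArow]
  have hcol (v) : ∑ u, M u v = 1 := by
    obtain ⟨v, rfl⟩ := F.surjective v
    rw [← hArow v]
    refine Finset.sum_congr rfl fun u _ => ?_
    rw [hMA, hA, hA, if_congr (hsymmE u v) rfl rfl]
  have hM (y : Fin N → ℝ) (hy : ∑ i, y i = 0) :
      ∑ i, (M *ᵥ y) i ^ 2 ≤ α ^ 2 * ∑ i, y i ^ 2 := by
    have hMy : M *ᵥ y = A *ᵥ (y ∘ F) := by
      ext u
      simp only [Matrix.mulVec, dotProduct, Function.comp, ← hMA]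
      exact (Equiv.sum_comp F fun v => M u v * y v).symm
    have h := hcontract (y ∘ F) (by simpa using (Equiv.sum_comp F y).trans hy)
    rw [← hMy] at h
    have hF : ∑ i, (y ∘ F) i ^ 2 = ∑ i, y i ^ 2 := Equiv.sum_comp F fun i => y i ^ 2
    have h2 := pow_le_pow_left₀ (Real.sqrt_nonneg _) h 2
    unfold euclNorm at h2
    rwa [mul_pow, Real.sq_sqrt (Finset.sum_nonneg fun _ _ => sq_nonneg _),
      Real.sq_sqrt (Finset.sum_nonneg fun _ _ => sq_nonneg _), hF] at h2
  have hμ' (i) : μ i = #(S i) / (Fintype.card (Fin N) : ℝ) := by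
    rw [hμ, ← sum_walkMass_update_univ hrow hcol t i (S i), ← card_walks_div_pow E' d t,
      Fintype.card_fin, div_div, mul_comm (N : ℝ)]
    congr 3
    refine Finset.filter_congr fun w _ => and_congr_right fun _ => ?_
    refine ⟨fun h j => ?_, fun h => ?_⟩
    · split_ifs with hj
      · exact hj ▸ h
      · exact mem_univ _
    · simpa using h i
  simp only [hμ', hβ]
  rw [mul_comm (N : ℝ), ← div_div, card_walks_div_pow]
  have h := sum_walkMass_le hrow hcol hα0 hα1 hM t S
  rwa [Fintype.card_fin] at h ⊢
end

section
/- Let G = (V, E) be a d-regular undirected graph on N vertices whose transition matrix A (entries 1/d on edges, 0 otherwise) satisfies ‖A·y‖ ≤ α‖y‖ for every y ∈ ℝ^N orthogonal to the all-ones vector, where 0 ≤ α < 1 and β = 1 − α. Let Ω be the set of (undirected) t-walks in G, i.e., tuples (y_0, …, y_t) ∈ V^{t+1} with {y_i, y_{i+1}} ∈ E for each i < t, equipped with the uniform probability measure P, and let U_i(y_0, …, y_t) = y_i be the projection maps. Then the U_i are β-independent: for all subsets S_0, …, S_t ⊆ V, P(⋂_{0≤i≤t} U_i⁻¹(S_i))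 ≤ ∏_{0≤i≤t} (α + β·μ_i), where μ_i = P(U_i⁻¹(S_i)) = |S_i|/N. -/
open Finset Matrix

/-- The mass of the walks starting at `v` whose `i`-th vertex lies in `S i` for all `i`, each step
being weighted by the matrix `A`. -/
noncomputable def confinedMass {N : ℕ} (A : Matrix (Fin N) (Fin N) ℝ) :
    (t : ℕ) → (Fin (t + 1) → Finset (Fin N)) → Fin N → ℝ
  | 0, S, v => if v ∈ S 0 then 1 else 0
  | t + 1, S, v =>
      if v ∈ S 0 then ∑ u, A v u * confinedMass A t (fun i => S i.succ) u else 0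

lemma confinedMass_eq_zero {N : ℕ} (A : Matrix (Fin N) (Fin N) ℝ) (t : ℕ)
    (S : Fin (t + 1) → Finset (Fin N)) {v : Fin N} (hv : v ∉ S 0) :
    confinedMass A t S v = 0 := by
  cases t <;> simp [confinedMass, hv]

/-- Sums over walks confined to `S`, weighted by a function of the initial vertex. -/
lemma sum_walks_eq_sum_confinedMass {N d : ℕ} (hd : 1 ≤ d)
    (E : Fin N → Fin N → Prop) [DecidableRel E]
    (A : Matrix (Fin N) (Fin N) ℝ)
    (hA : ∀ i j, A i j = if E i j then 1 / (d : ℝ) else 0)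
    (t : ℕ) (S : Fin (t + 1) → Finset (Fin N)) (h : Fin N → ℝ) :
    ∑ w : Fin (t + 1) → Fin N, h (w 0) *
      (if (∀ i : Fin t, E (w i.castSucc) (w i.succ)) ∧ ∀ i, w i ∈ S i then 1 else 0)
      = (d : ℝ) ^ t * ∑ v, h v * confinedMass A t S v := by
  have hd' : (d : ℝ) ≠ 0 := by positivity
  induction t generalizing h with
  | zero =>
    rw [← (Fin.consEquiv (fun _ => Fin N)).sum_comp, Fintype.sum_prod_type]
    simp [confinedMass, Fin.consEquiv]
  | succ t ih =>
    rw [← (Fin.consEquiv (fun _ => Fin N)).sum_comp, Fintype.sum_prod_type, mul_sum]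
    refine sum_congr rfl fun v _ => ?_
    have key := ih (fun i => S i.succ) (fun u => if E v u then 1 else 0)
    have hE : ∀ u, (if E v u then (1 : ℝ) else 0) = d * A v u := by
      intro u
      rw [hA]
      split_ifs <;> simp [hd']
    simp_rw [hE, mul_assoc, ← mul_sum] at key
    by_cases hv : v ∈ S 0
    · rw [confinedMass, if_pos hv, pow_succ, mul_left_comm, mul_assoc, ← key, mul_sum, mul_sum]
      refine sum_congr rfl fun w _ => ?_
      rw [← mul_assoc (d : ℝ), ← hE]
      by_cases hw : E v (w 0) <;>
        simp [Fin.consEquiv, Fin.forall_fin_succ (n := t), Fin.forall_fin_succ (n := t + 1), hv, hw]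
    · rw [confinedMass, if_neg hv, mul_zero, mul_zero]
      refine sum_eq_zero fun w _ => ?_
      rw [if_neg, mul_zero]
      rintro ⟨-, h2⟩
      exact hv (by simpa [Fin.consEquiv] using h2 0)

lemma card_walks_eq_sum_confinedMass {N d : ℕ} (hd : 1 ≤ d)
    (E : Fin N → Fin N → Prop) [DecidableRel E]
    (A : Matrix (Fin N) (Fin N) ℝ)
    (hA : ∀ i j, A i j = if E i j then 1 / (d : ℝ) else 0)
    (t : ℕ) (S : Fin (t + 1) → Finset (Fin N)) :
    ((Finset.univ.filter (fun w : Fin (t + 1) → Fin N =>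
        (∀ i : Fin t, E (w i.castSucc) (w i.succ)) ∧ ∀ i, w i ∈ S i)).card : ℝ)
      = (d : ℝ) ^ t * ∑ v, confinedMass A t S v := by
  have h := sum_walks_eq_sum_confinedMass hd E A hA t S 1
  simp only [Pi.one_apply, one_mul] at h
  rw [← h, sum_boole]

lemma confinedMass_univ {N : ℕ} (A : Matrix (Fin N) (Fin N) ℝ) (hrow : ∀ i, ∑ j, A i j = 1)
    (t : ℕ) (v : Fin N) : confinedMass A t (fun _ => univ) v = 1 := by
  induction t generalizing v with
  | zero => simp [confinedMass]
  | succ t ih => simp [confinedMass, ih, hrow]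

/-- Every coordinate of the stationary walk of a doubly stochastic matrix is uniform. -/
lemma sum_confinedMass_single {N : ℕ} (A : Matrix (Fin N) (Fin N) ℝ)
    (hrow : ∀ i, ∑ j, A i j = 1) (hcol : ∀ j, ∑ i, A i j = 1)
    (t : ℕ) (i : Fin (t + 1)) (T : Finset (Fin N)) :
    ∑ v, confinedMass A t (fun j => if j = i then T else univ) v = T.card := by
  induction t with
  | zero =>
    obtain rfl : i = 0 := Fin.fin_one_eq_zero i
    simp [confinedMass]
  | succ t ih =>
    refine Fin.cases ?_ (fun j => ?_) i
    · simp [confinedMass, confinedMass_univ A hrow, hrow]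
    · simp only [confinedMass, (Fin.succ_ne_zero j).symm, if_false, mem_univ, if_true,
        Fin.succ_inj]
      rw [sum_comm]
      simp_rw [← sum_mul, hcol, one_mul]
      exact ih j

/-- Expander mixing bound for vectors supported on sets of given density. -/
lemma sq_sum_mul_mulVec_le_s12 {N : ℕ} (hN : 1 ≤ N) (A : Matrix (Fin N) (Fin N) ℝ)
    (hrow : ∀ i, ∑ j, A i j = 1) (hcol : ∀ j, ∑ i, A i j = 1)
    {α : ℝ} (hα0 : 0 ≤ α) (hα1 : α ≤ 1)
    (hcontract : ∀ y : Fin N → ℝ, (∑ i, y i) = 0 →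
      ∑ i, (A.mulVec y) i ^ 2 ≤ α ^ 2 * ∑ i, y i ^ 2)
    (S T : Finset (Fin N)) (x y : Fin N → ℝ)
    (hx : ∀ v, v ∉ S → x v = 0) (hy : ∀ v, v ∉ T → y v = 0) :
    (∑ v, x v * (A.mulVec y) v) ^ 2 ≤
      (α + (1 - α) * (S.card / N)) * (α + (1 - α) * (T.card / N))
        * ((∑ v, x v ^ 2) * ∑ v, y v ^ 2) := by
  have hN' : (0 : ℝ) < N := by exact_mod_cast hN
  have hden : ∀ (S : Finset (Fin N)) (x : Fin N → ℝ), (∀ v, v ∉ S → x v = 0) →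
      N * ((∑ v, x v) / N) ^ 2 ≤ S.card / N * ∑ v, x v ^ 2 := by
    intro S x hx
    have h1 : ∑ v, x v = ∑ v ∈ S, x v :=
      (sum_subset (subset_univ S) fun v _ hv => hx v hv).symm
    have h2 : ∑ v, x v ^ 2 = ∑ v ∈ S, x v ^ 2 :=
      (sum_subset (subset_univ S) fun v _ hv => by simp [hx v hv]).symm
    have h3 := sq_sum_le_card_mul_sum_sq (s := S) (f := x)
    rw [h1, h2]
    calc N * ((∑ v ∈ S, x v) / N) ^ 2 = (∑ v ∈ S, x v) ^ 2 / N := by field_simp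
      _ ≤ (S.card * ∑ v ∈ S, x v ^ 2) / N := by gcongr
      _ = _ := by ring
  have hmean : ∀ x : Fin N → ℝ, ∑ v, (x v - (∑ v, x v) / N) = 0 := by
    intro x
    rw [sum_sub_distrib]
    simp
    field_simp
    simp
  have hpyth : ∀ x : Fin N → ℝ, ∑ v, x v ^ 2 =
      N * ((∑ v, x v) / N) ^ 2 + ∑ v, (x v - (∑ v, x v) / N) ^ 2 := by
    intro x
    have h := hmean x
    set a := (∑ v, x v) / N
    have : ∀ v, x v ^ 2 = a ^ 2 + (x v - a) ^ 2 + 2 * a * (x v - a) := fun v => by ring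
    rw [sum_congr rfl fun v _ => this v, sum_add_distrib, sum_add_distrib, ← mul_sum, h]
    simp
  have hSx := hden S x hx
  have hTy := hden T y hy
  have hpx := hpyth x
  have hpy := hpyth y
  have hmx := hmean x
  have hmy := hmean y
  set a := (∑ v, x v) / N
  set b := (∑ v, y v) / N
  set x' : Fin N → ℝ := fun v => x v - a
  set y' : Fin N → ℝ := fun v => y v - b
  have hAy : ∀ v, (A.mulVec y) v = (A.mulVec y') v + b := by
    intro v
    simp only [mulVec, dotProduct, y', mul_sub, sum_sub_distrib, ← sum_mul, hrow]
    ring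
  have hsumA : ∑ v, (A.mulVec y') v = 0 := by
    simp only [mulVec, dotProduct]
    rw [sum_comm]
    simp_rw [← sum_mul, hcol, one_mul]
    exact hmy
  have hbil : ∑ v, x v * (A.mulVec y) v = N * a * b + ∑ v, x' v * (A.mulVec y') v := by
    have : ∀ v, x v * (A.mulVec y) v =
        x' v * (A.mulVec y') v + b * x' v + a * (A.mulVec y') v + a * b := by
      intro v
      rw [hAy]
      simp only [x']
      ring
    rw [sum_congr rfl fun v _ => this v]
    simp only [sum_add_distrib, ← mul_sum, hsumA]
    rw [show ∑ v, x' v = 0 from hmx]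
    simp
    ring
  have hq : (∑ v, x' v * (A.mulVec y') v) ^ 2 ≤
      α ^ 2 * ((∑ v, x' v ^ 2) * ∑ v, y' v ^ 2) := by
    refine (sum_mul_sq_le_sq_mul_sq univ x' (A.mulVec y')).trans ?_
    have := mul_le_mul_of_nonneg_left (hcontract y' hmy)
      (sum_nonneg fun v _ => sq_nonneg (x' v) : 0 ≤ ∑ v, x' v ^ 2)
    linarith
  have hX : 0 ≤ ∑ v, x' v ^ 2 := sum_nonneg fun v _ => sq_nonneg _
  have hY : 0 ≤ ∑ v, y' v ^ 2 := sum_nonneg fun v _ => sq_nonneg _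
  rw [hbil]
  change ∑ v, x v ^ 2 = N * a ^ 2 + ∑ v, x' v ^ 2 at hpx
  change ∑ v, y v ^ 2 = N * b ^ 2 + ∑ v, y' v ^ 2 at hpy
  set X := ∑ v, x' v ^ 2
  set Y := ∑ v, y' v ^ 2
  set q := ∑ v, x' v * (A.mulVec y') v
  have hcross : 2 * a * b * q ≤ α * (a ^ 2 * Y + b ^ 2 * X) := by
    refine abs_le_of_sq_le_sq' ?_ (by positivity) |>.2
    have h1 : (2 * a * b * q) ^ 2 ≤ 4 * a ^ 2 * b ^ 2 * (α ^ 2 * (X * Y)) := by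
      have := mul_le_mul_of_nonneg_left hq (by positivity : 0 ≤ 4 * a ^ 2 * b ^ 2)
      linarith
    have h2 : 0 ≤ α ^ 2 * (a ^ 2 * Y - b ^ 2 * X) ^ 2 := by positivity
    linarith
  have hmain : (N * a * b + q) ^ 2 ≤ (N * a ^ 2 + α * X) * (N * b ^ 2 + α * Y) := by
    have := mul_le_mul_of_nonneg_left hcross hN'.le
    linarith
  have hfx : N * a ^ 2 + α * X ≤ (α + (1 - α) * (S.card / N)) * ∑ v, x v ^ 2 := by
    have := mul_le_mul_of_nonneg_left hSx (sub_nonneg.2 hα1)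
    have h2 : N * a ^ 2 + α * X = α * (∑ v, x v ^ 2) + (1 - α) * (N * a ^ 2) := by
      rw [hpx]; ring
    linarith
  have hfy : N * b ^ 2 + α * Y ≤ (α + (1 - α) * (T.card / N)) * ∑ v, y v ^ 2 := by
    have := mul_le_mul_of_nonneg_left hTy (sub_nonneg.2 hα1)
    have h2 : N * b ^ 2 + α * Y = α * (∑ v, y v ^ 2) + (1 - α) * (N * b ^ 2) := by
      rw [hpy]; ring
    linarith
  calc _ ≤ _ := hmain
    _ ≤ _ := mul_le_mul hfx hfy (by positivity) (le_trans (by positivity) hfx)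
    _ = _ := by ring

lemma density_le_affine {N : ℕ} (hN : 1 ≤ N) {α : ℝ} (hα0 : 0 ≤ α) (S : Finset (Fin N)) :
    (S.card : ℝ) / N ≤ α + (1 - α) * (S.card / N) := by
  have hN' : (0 : ℝ) < N := by exact_mod_cast hN
  have h : (S.card : ℝ) / N ≤ 1 := by
    rw [div_le_one hN']
    exact_mod_cast (card_le_univ S).trans_eq (Fintype.card_fin N)
  nlinarith

lemma sum_sq_confinedMass_le {N : ℕ} (hN : 1 ≤ N) (A : Matrix (Fin N) (Fin N) ℝ)
    (hrow : ∀ i, ∑ j, A i j = 1) (hcol : ∀ j, ∑ i, A i j = 1)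
    {α : ℝ} (hα0 : 0 ≤ α) (hα1 : α ≤ 1)
    (hcontract : ∀ y : Fin N → ℝ, (∑ i, y i) = 0 →
      ∑ i, (A.mulVec y) i ^ 2 ≤ α ^ 2 * ∑ i, y i ^ 2)
    (t : ℕ) (S : Fin (t + 1) → Finset (Fin N)) :
    ∑ v, confinedMass A t S v ^ 2 ≤ N * ((α + (1 - α) * ((S 0).card / N))
      * (∏ i : Fin t, (α + (1 - α) * ((S i.succ).card / N))) ^ 2) := by
  have hN' : (0 : ℝ) < N := by exact_mod_cast hN
  induction t with
  | zero =>
    have h := mul_le_mul_of_nonneg_left (density_le_affine hN hα0 (S 0)) hN'.le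
    rw [mul_div_cancel₀ _ hN'.ne'] at h
    simpa [confinedMass] using h
  | succ t ih =>
    have hc : ∀ T : Finset (Fin N), 0 ≤ α + (1 - α) * (T.card / N : ℝ) := fun T =>
      le_trans (by positivity) (density_le_affine hN hα0 T)
    have hmix := sq_sum_mul_mulVec_le_s12 hN A hrow hcol hα0 hα1 hcontract (S 0) (S (Fin.succ 0))
      (confinedMass A (t + 1) S) (confinedMass A t fun i => S i.succ)
      (fun v hv => confinedMass_eq_zero A _ S hv)
      (fun v hv => confinedMass_eq_zero A _ (fun i => S i.succ) hv)
    have hself : ∑ v, confinedMass A (t + 1) S v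
          * (A.mulVec (confinedMass A t fun i => S i.succ)) v
        = ∑ v, confinedMass A (t + 1) S v ^ 2 := by
      refine sum_congr rfl fun v _ => ?_
      by_cases hv : v ∈ S 0
      · simp [confinedMass, hv, mulVec, dotProduct, sq]
      · simp [confinedMass_eq_zero A _ S hv]
    rw [hself] at hmix
    have ih' := ih (fun i => S i.succ)
    rw [Fin.prod_univ_succ]
    have hX : 0 ≤ ∑ v, confinedMass A (t + 1) S v ^ 2 := sum_nonneg fun v _ => sq_nonneg _
    have hY : 0 ≤ ∑ v, confinedMass A t (fun i => S i.succ) v ^ 2 :=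
      sum_nonneg fun v _ => sq_nonneg _
    set X := ∑ v, confinedMass A (t + 1) S v ^ 2
    set Y := ∑ v, confinedMass A t (fun i => S i.succ) v ^ 2
    have h0 := hc (S 0)
    have h1 := hc (S (Fin.succ 0))
    set c₀ := α + (1 - α) * ((S 0).card / N : ℝ)
    set c₁ := α + (1 - α) * ((S (Fin.succ 0)).card / N : ℝ)
    have hXY : X ≤ c₀ * c₁ * Y := by
      rcases hX.eq_or_lt with h | h
      · rw [← h]
        positivity
      · refine le_of_mul_le_mul_right ?_ h
        linarith
    refine hXY.trans ((mul_le_mul_of_nonneg_left ih' (mul_nonneg h0 h1)).trans_eq ?_)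
    ring

lemma sum_confinedMass_le {N : ℕ} (hN : 1 ≤ N) (A : Matrix (Fin N) (Fin N) ℝ)
    (hrow : ∀ i, ∑ j, A i j = 1) (hcol : ∀ j, ∑ i, A i j = 1)
    {α : ℝ} (hα0 : 0 ≤ α) (hα1 : α ≤ 1)
    (hcontract : ∀ y : Fin N → ℝ, (∑ i, y i) = 0 →
      ∑ i, (A.mulVec y) i ^ 2 ≤ α ^ 2 * ∑ i, y i ^ 2)
    (t : ℕ) (S : Fin (t + 1) → Finset (Fin N)) :
    ∑ v, confinedMass A t S v ≤ N * ∏ i, (α + (1 - α) * ((S i).card / N)) := by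
  have hN' : (0 : ℝ) < N := by exact_mod_cast hN
  have hc : ∀ T : Finset (Fin N), 0 ≤ α + (1 - α) * (T.card / N : ℝ) := fun T =>
    le_trans (by positivity) (density_le_affine hN hα0 T)
  refine (abs_le_of_sq_le_sq' ?_ (mul_nonneg hN'.le (prod_nonneg fun i _ => hc _))).2
  have h1 : ∑ v, confinedMass A t S v = ∑ v ∈ S 0, confinedMass A t S v :=
    (sum_subset (subset_univ _) fun v _ hv => confinedMass_eq_zero A t S hv).symm
  have h2 : ∑ v ∈ S 0, confinedMass A t S v ^ 2 ≤ ∑ v, confinedMass A t S v ^ 2 :=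
    sum_le_sum_of_subset_of_nonneg (subset_univ _) fun _ _ _ => sq_nonneg _
  have h3 : ((S 0).card : ℝ) ≤ N * (α + (1 - α) * ((S 0).card / N)) := by
    have h := mul_le_mul_of_nonneg_left (density_le_affine hN hα0 (S 0)) hN'.le
    rwa [mul_div_cancel₀ _ hN'.ne'] at h
  have h4 := h2.trans (sum_sq_confinedMass_le hN A hrow hcol hα0 hα1 hcontract t S)
  rw [h1, Fin.prod_univ_succ]
  refine sq_sum_le_card_mul_sum_sq.trans ((mul_le_mul h3 h4 (sum_nonneg fun _ _ => sq_nonneg _)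
    (mul_nonneg hN'.le (hc _))).trans_eq ?_)
  ring

/-- Let `G = (V, E)` be a `d`-regular undirected graph on `N` vertices
whose transition matrix `A` contracts by a factor `α ∈ [0,1)` on the orthogonal
complement of the all-ones vector, and `β = 1 - α`.  Equip the set of (undirected)
`t`-walks in `G` (of which there are `N·d^t`) with the uniform measure, and let `U i`
be the `i`-th vertex projection.  Then the `U i` are β-independent: for all
`S₀, …, S_t ⊆ V`, `P(⋂ i, U i ⁻¹ (S i)) ≤ ∏ i, (α + β·μ i)` where
`μ i = P(U i ⁻¹ (S i))`. -/
theorem beta_independence_of_expander_walks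
    (N d t : ℕ) (hN : 1 ≤ N) (hd : 1 ≤ d)
    (E : Fin N → Fin N → Prop) [DecidableRel E]
    (hsymmE : ∀ u v, E u v ↔ E v u)
    (hreg : ∀ u, (Finset.univ.filter (fun v => E u v)).card = d)
    (A : Matrix (Fin N) (Fin N) ℝ)
    (hA : ∀ i j, A i j = if E i j then 1 / (d : ℝ) else 0)
    (α β : ℝ) (hα0 : 0 ≤ α) (hα1 : α < 1) (hβ : β = 1 - α)
    (hcontract : ∀ y : Fin N → ℝ, (∑ i, y i) = 0 →
      euclNorm (A.mulVec y) ≤ α * euclNorm y)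
    (S : Fin (t + 1) → Finset (Fin N))
    (μ : Fin (t + 1) → ℝ)
    (hμ : ∀ i, μ i =
      ((Finset.univ.filter (fun w : Fin (t + 1) → Fin N =>
          (∀ i' : Fin t, E (w i'.castSucc) (w i'.succ)) ∧ w i ∈ S i)).card : ℝ)
        / (N * d ^ t)) :
    ((Finset.univ.filter (fun w : Fin (t + 1) → Fin N =>
        (∀ i' : Fin t, E (w i'.castSucc) (w i'.succ)) ∧ ∀ i, w i ∈ S i)).card : ℝ)
      / (N * d ^ t)
    ≤ ∏ i, (α + β * μ i) := by
  have hN' : (0 : ℝ) < N := by exact_mod_cast hN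
  have hd' : (0 : ℝ) < d := by exact_mod_cast hd
  have hrow : ∀ i, ∑ j, A i j = 1 := by
    intro i
    simp_rw [hA]
    rw [← sum_filter, sum_const, hreg, nsmul_eq_mul]
    field_simp
  have hcol : ∀ j, ∑ i, A i j = 1 := by
    intro j
    rw [← hrow j]
    refine sum_congr rfl fun i _ => ?_
    simp only [hA, hsymmE i j]
  have hsq : ∀ y : Fin N → ℝ, (∑ i, y i) = 0 →
      ∑ i, (A.mulVec y) i ^ 2 ≤ α ^ 2 * ∑ i, y i ^ 2 := by
    intro y hy
    have h := pow_le_pow_left₀ (Real.sqrt_nonneg _) (hcontract y hy) 2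
    unfold euclNorm at h
    rwa [mul_pow, Real.sq_sqrt (sum_nonneg fun _ _ => sq_nonneg _),
      Real.sq_sqrt (sum_nonneg fun _ _ => sq_nonneg _)] at h
  have hμ' : ∀ i, μ i = (S i).card / N := by
    intro i
    have h := card_walks_eq_sum_confinedMass hd E A hA t (fun j => if j = i then S i else univ)
    rw [sum_confinedMass_single A hrow hcol] at h
    have hiff : ∀ w : Fin (t + 1) → Fin N,
        (∀ j, w j ∈ (if j = i then S i else univ)) ↔ w i ∈ S i := by
      intro w
      refine ⟨fun hw => by simpa using hw i, fun hw j => ?_⟩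
      split_ifs with hj
      · rwa [hj]
      · exact mem_univ _
    simp_rw [hiff] at h
    rw [hμ, h]
    field_simp
  simp_rw [hμ', hβ]
  rw [card_walks_eq_sum_confinedMass hd E A hA, div_le_iff₀ (by positivity)]
  have h := mul_le_mul_of_nonneg_left
    (sum_confinedMass_le hN A hrow hcol hα0 hα1.le hsq t S) (pow_pos hd' t).le
  linarith
end

section
/- Fix 0 < p < 1 and an integer t ≥ 1. Let Ω = [0,1]^t with the product Lebesgue (uniform) probability measure P, let Z : Ω → ℝ be the indicator function of the event [0, p^{1/t}]^t, and let U_i(y_0, …, y_{t−1}) = y_i be the coordinate projections to [0,1]. Then: (a) E[Z] = p; (b) for each i, the function W_i : [0,1] → ℝ defined by W_i(x) = p^{1−1/t} if x ≤ p^{1/t} and W_i(x) = 0 otherwise is a version of the conditional expectation E[Z|U_i]; and (c) for every ε with 0 < ε < p^{1−1/t}, the Lebesgue measure of {x ∈ [0,1] : W_i(x) > ε} equals p^{1/t} = E[Z]^{1/t}. -/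
open MeasureTheory

theorem MeasureTheory.Measure.pi_real_univ_pi_inter_preimage_eval {ι α : Type*} [Fintype ι]
    [MeasurableSpace α] (μ : Measure α) [SigmaFinite μ] (A S : Set α) (i : ι) :
    (Measure.pi fun _ : ι => μ).real ((Set.univ.pi fun _ => A) ∩ (fun ω => ω i) ⁻¹' S)
      = μ.real (A ∩ S) * μ.real A ^ (Fintype.card ι - 1) := by
  classical
  have h : (Set.univ.pi fun _ : ι => A) ∩ (fun ω : ι → α => ω i) ⁻¹' S
      = Set.univ.pi (Function.update (fun _ => A) i (A ∩ S)) := by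
    ext ω
    simp only [Set.mem_inter_iff, Set.mem_univ_pi, Set.mem_preimage]
    constructor
    · rintro ⟨h1, h2⟩ j
      rcases eq_or_ne j i with rfl | hj
      · simpa using ⟨h1 j, h2⟩
      · simpa [hj] using h1 j
    · intro h
      have hi : ω i ∈ A ∩ S := by simpa using h i
      refine ⟨fun j => ?_, hi.2⟩
      rcases eq_or_ne j i with rfl | hj
      · exact hi.1
      · simpa [hj] using h j
  rw [h, Measure.real, Measure.pi_pi, ENNReal.toReal_prod,
    ← Finset.mul_prod_erase _ _ (Finset.mem_univ i), Function.update_self,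
    Finset.prod_congr rfl (g := fun _ => μ.real A)
      (fun j hj => by rw [Function.update_of_ne (Finset.ne_of_mem_erase hj), Measure.real])]
  simp [Measure.real, Finset.card_erase_of_mem]

/-- Fix `0 < p < 1` and an integer `t ≥ 1`.  Let `P` be the uniform
(product Lebesgue) probability measure on the cube `[0,1]^t`, `Z` the indicator function
of the event `[0, p^{1/t}]^t`, and `U i` the coordinate projections.  Then:
(a) `E[Z] = p`;
(b) for each `i`, the function `W` with `W x = p^{1-1/t}` for `x ≤ p^{1/t}` and `W x = 0`
otherwise is a version of the conditional expectation `E[Z | U i]`; and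
(c) for every `0 < ε < p^{1-1/t}`, the Lebesgue measure of `{x ∈ [0,1] : W x > ε}`
equals `p^{1/t} = E[Z]^{1/t}`. -/
theorem cube_example
    (p : ℝ) (hp0 : 0 < p) (hp1 : p < 1)
    (t : ℕ) (ht : 1 ≤ t)
    (P : Measure (Fin t → ℝ))
    (hP : P = Measure.pi (fun _ => volume.restrict (Set.Icc (0 : ℝ) 1)))
    (Z : (Fin t → ℝ) → ℝ)
    (hZ : Z = Set.indicator (Set.univ.pi fun _ : Fin t =>
      Set.Icc (0 : ℝ) (p ^ ((1 : ℝ) / t))) (fun _ => 1))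
    (W : ℝ → ℝ)
    (hW : W = fun x => if x ≤ p ^ ((1 : ℝ) / t) then p ^ (1 - (1 : ℝ) / t) else 0) :
    -- (a)
    (∫ ω, Z ω ∂P = p) ∧
    -- (b)
    (∀ i : Fin t, ∀ S : Set ℝ, MeasurableSet S →
      ∫ ω in (fun ω => ω i) ⁻¹' S, Z ω ∂P
        = ∫ x in S, W x ∂(P.map (fun ω => ω i))) ∧
    -- (c)
    (∀ ε : ℝ, 0 < ε → ε < p ^ (1 - (1 : ℝ) / t) →
      volume {x ∈ Set.Icc (0 : ℝ) 1 | ε < W x}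
        = ENNReal.ofReal (p ^ ((1 : ℝ) / t)) ∧
      p ^ ((1 : ℝ) / t) = (∫ ω, Z ω ∂P) ^ ((1 : ℝ) / t)) := by
  have ht0 : (t : ℝ) ≠ 0 := by positivity
  set c := p ^ ((1 : ℝ) / t) with hc
  have hc0 : 0 < c := Real.rpow_pos_of_pos hp0 _
  have hc1 : c ≤ 1 := Real.rpow_le_one hp0.le hp1.le (by positivity)
  have hct : c ^ t = p := by
    rw [hc, ← Real.rpow_natCast, ← Real.rpow_mul hp0.le, one_div_mul_cancel ht0, Real.rpow_one]
  have hct' : p ^ (1 - (1 : ℝ) / t) = c ^ (t - 1) := by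
    rw [hc, ← Real.rpow_natCast, ← Real.rpow_mul hp0.le, Nat.cast_sub ht]
    congr 1
    field_simp
    simp
  set μ : Measure ℝ := volume.restrict (Set.Icc (0 : ℝ) 1)
  have : IsProbabilityMeasure μ := ⟨by simp [μ]⟩
  have hμ : μ.real (Set.Icc 0 c) = c := by
    rw [measureReal_restrict_apply measurableSet_Icc, Set.inter_eq_left.2
      (Set.Icc_subset_Icc_right hc1), Real.volume_real_Icc_of_le hc0.le, sub_zero]
  have hbox : MeasurableSet (Set.univ.pi fun _ : Fin t => Set.Icc (0 : ℝ) c) :=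
    MeasurableSet.univ_pi fun _ => measurableSet_Icc
  have hZp : ∫ ω, Z ω ∂P = p := by
    rw [hZ, hP, integral_indicator_const _ hbox, Measure.real, Measure.pi_pi,
      ENNReal.toReal_prod]
    simpa [← Measure.real_def, hμ] using hct
  refine ⟨hZp, fun i S hS => ?_, fun ε hε hεc => ⟨?_, by rw [hZp]⟩⟩
  · have hW' : W = (Set.Iic c).indicator fun _ => c ^ (t - 1) := by
      funext x
      simp only [hW, hct', Set.indicator_apply, Set.mem_Iic]
    have hIic : μ.real (Set.Icc 0 c ∩ S) = μ.real (Set.Iic c ∩ S) := by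
      rw [measureReal_restrict_apply (measurableSet_Icc.inter hS),
        measureReal_restrict_apply (measurableSet_Iic.inter hS)]
      congr 1
      ext x
      simp only [Set.mem_inter_iff, Set.mem_Icc, Set.mem_Iic]
      tauto
    rw [hP, (measurePreserving_eval (fun _ : Fin t => μ) i).map_eq, hZ, hW',
      integral_indicator_const _ hbox, integral_indicator_const _ measurableSet_Iic,
      measureReal_restrict_apply hbox, measureReal_restrict_apply measurableSet_Iic,
      Measure.pi_real_univ_pi_inter_preimage_eval, hμ, hIic]
    simp
  · have hset : {x ∈ Set.Icc (0 : ℝ) 1 | ε < W x} = Set.Icc 0 c := by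
      ext x
      simp only [hW, Set.mem_ofPred_eq, Set.mem_Icc]
      split_ifs with hx
      · exact ⟨fun h => ⟨h.1.1, hx⟩, fun h => ⟨⟨h.1, hx.trans hc1⟩, hεc⟩⟩
      · exact ⟨fun h => absurd h.2 hε.not_gt, fun h => absurd h.2 hx⟩
    rw [hset, Real.volume_Icc, sub_zero]
end
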